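/- arXiv:1911.05794 — 2 statements merged into one kernel-verified Lean document; each statement's English description precedes it below -/
import Mathlib

section
/- Let {s_n}_{n ≥ k} be a sequence of nonnegative integers such that (a) 2·s_n ≤ n − 3 for all n ≥ k, (b) s_n/n → 0 as n → ∞, and (c) 2^{s_n} ≥ n² for all n ≥ k. Let T_n = T_{n,s_n}. Then Den(T_n) → 1 as n → ∞. -/
open Filter Topology

noncomputable section

namespace SubtreePaper

/-- The set of subtrees of `G`: subgraphs of `G` that are (nonempty) trees. -/
def subtrees {V : Type*} (G : SimpleGraph V) : Set G.Subgraph :=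
  {H | H.coe.IsTree}

/-- The number of subtrees of `G`. -/
def numSubtrees {V : Type*} (G : SimpleGraph V) : ℕ := (subtrees G).ncard

/-- The mean subtree order of `G`. -/
def mu {V : Type*} (G : SimpleGraph V) : ℝ :=
  (∑ᶠ H ∈ subtrees G, (H.verts.ncard : ℝ)) / (numSubtrees G)

/-- The density of `G`. -/
def den {V : Type*} [Fintype V] (G : SimpleGraph V) : ℝ :=
  mu G / (Fintype.card V)

/-- The local mean subtree order of `G` at an edge `e`. -/
def muEdge {V : Type*} (G : SimpleGraph V) (e : Sym2 V) : ℝ :=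
  (∑ᶠ H ∈ {H ∈ subtrees G | e ∈ H.edgeSet}, (H.verts.ncard : ℝ)) /
    ({H ∈ subtrees G | e ∈ H.edgeSet}.ncard)

/-- The local mean subtree order of `G` at a vertex `u`. -/
def muVert {V : Type*} (G : SimpleGraph V) (u : V) : ℝ :=
  (∑ᶠ H ∈ {H ∈ subtrees G | u ∈ H.verts}, (H.verts.ncard : ℝ)) /
    ({H ∈ subtrees G | u ∈ H.verts}.ncard)

/-- The graph obtained from `G` by adding an edge between `u` and `v`. -/
def addEdge {V : Type*} (G : SimpleGraph V) (u v : V) : SimpleGraph V :=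
  G ⊔ SimpleGraph.fromEdgeSet {s(u, v)}


/-- The tree `T_{n,s}`: a path on the vertices `Sum.inl 0, …, Sum.inl (n - 2s - 1)`
(of order `n - 2s`), with the `s` leaves `Sum.inr (Sum.inl j)` attached to the
endvertex `Sum.inl 0`, and the `s` leaves `Sum.inr (Sum.inr j)` attached to the
endvertex `Sum.inl (n - 2s - 1)`. -/
def Tns (n s : ℕ) : SimpleGraph (Fin (n - 2 * s) ⊕ Fin s ⊕ Fin s) :=
  SimpleGraph.fromRel fun a b =>
    match a, b with
    | Sum.inl i, Sum.inl j => (i : ℕ) + 1 = (j : ℕ)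
    | Sum.inl i, Sum.inr (Sum.inl _) => (i : ℕ) = 0
    | Sum.inl i, Sum.inr (Sum.inr _) => (i : ℕ) = n - 2 * s - 1
    | _, _ => False

/-- The endvertex `u` of the path in `T_{n,s}`. -/
def pu (n s : ℕ) (h : 2 * s + 3 ≤ n) : Fin (n - 2 * s) ⊕ Fin s ⊕ Fin s :=
  Sum.inl ⟨0, by omega⟩

/-- The endvertex `v` of the path in `T_{n,s}`. -/
def pv (n s : ℕ) (h : 2 * s + 3 ≤ n) : Fin (n - 2 * s) ⊕ Fin s ⊕ Fin s :=
  Sum.inl ⟨n - 2 * s - 1, by omega⟩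

/-- The graph `G_{n,s}`, obtained from `T_{n,s}` by adding the edge `uv`. -/
def Gns (n s : ℕ) (h : 2 * s + 3 ≤ n) :
    SimpleGraph (Fin (n - 2 * s) ⊕ Fin s ⊕ Fin s) :=
  addEdge (Tns n s) (pu n s h) (pv n s h)

/-- The density of `G_{n,s}` (with junk value `0` when `2s > n - 3`). -/
def GnsDen (n s : ℕ) : ℝ :=
  if h : 2 * s + 3 ≤ n then den (Gns n s h) else 0

/-- The number of subtrees of `G_{n,s}` (with junk value `0` when `2s > n - 3`). -/
def GnsNum (n s : ℕ) : ℕ :=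
  if h : 2 * s + 3 ≤ n then numSubtrees (Gns n s h) else 0

/-- A graph in which every vertex has at most one neighbour of rank at most its own is acyclic. -/
theorem isAcyclic_of_rank {V : Type*} {G : SimpleGraph V} (r : V → ℕ)
    (h : ∀ v a b, G.Adj v a → G.Adj v b → r a ≤ r v → r b ≤ r v → a = b) : G.IsAcyclic := by
  classical
  intro v c hc
  obtain ⟨w, hw, hmax⟩ := c.support.toFinset.exists_max_image r ⟨v, by simp⟩
  rw [List.mem_toFinset] at hw
  have hc' := hc.rotate hw
  have hle : ∀ x ∈ (c.rotate w hw).support, r x ≤ r w := fun x hx =>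
    hmax x (by simpa [SimpleGraph.Walk.mem_support_rotate_iff] using hx)
  exact hc'.snd_ne_penultimate (h w _ _ (SimpleGraph.Walk.adj_snd hc'.not_nil)
    (SimpleGraph.Walk.adj_penultimate hc'.not_nil).symm
    (hle _ (SimpleGraph.Walk.getVert_mem_support _ _))
    (hle _ (SimpleGraph.Walk.getVert_mem_support _ _)))

/-- Connected subgraphs of an acyclic graph are induced. -/
theorem verts_injOn_subtrees {V : Type*} {G : SimpleGraph V} (hG : G.IsAcyclic) :
    Set.InjOn (fun H : G.Subgraph => H.verts) (subtrees G) := by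
  have key : ∀ H ∈ subtrees G, ∀ a ∈ H.verts, ∀ b ∈ H.verts, H.Adj a b ↔ G.Adj a b := by
    intro H hH a ha b hb
    have hH' : H.coe.IsTree := hH
    have hle : H.coe ≤ G.induce H.verts := fun x y hxy => H.adj_sub hxy
    have htree : (G.induce H.verts).IsTree := ⟨hH'.connected.mono hle, hG.induce _⟩
    have hge := (SimpleGraph.isTree_iff_minimal_connected.1 htree).2 hH'.connected hle
    exact ⟨fun h => H.adj_sub h, fun h => @hge ⟨a, ha⟩ ⟨b, hb⟩ h⟩
  intro H hH K hK hHK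
  have hv : H.verts = K.verts := hHK
  refine SimpleGraph.Subgraph.ext hv ?_
  funext a b
  refine propext ⟨fun h => ?_, fun h => ?_⟩
  · exact (key K hK a (hv ▸ h.fst_mem) b (hv ▸ h.snd_mem)).2 (H.adj_sub h)
  · exact (key H hH a (hv ▸ h.fst_mem) b (hv ▸ h.snd_mem)).2 (K.adj_sub h)

/-- A predicate preserved along the edges of a subtree is constant on its vertices. -/
theorem subtree_constant {V : Type*} {G : SimpleGraph V} {H : G.Subgraph} (hH : H ∈ subtrees G)
    (P : V → Prop) (hP : ∀ a ∈ H.verts, ∀ b ∈ H.verts, G.Adj a b → P a → P b)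
    {a b : V} (ha : a ∈ H.verts) (hb : b ∈ H.verts) (h : P a) : P b := by
  have hH' : H.coe.IsTree := hH
  obtain ⟨w⟩ := hH'.connected.preconnected ⟨a, ha⟩ ⟨b, hb⟩
  have : ∀ x y : H.verts, H.coe.Walk x y → P x → P y := by
    intro x y w
    induction w with
    | nil => exact id
    | cons hadj _ ih => exact fun hx => ih (hP _ (Subtype.prop _) _ (Subtype.prop _)
        (H.adj_sub hadj) hx)
  exact this _ _ w h

theorem Tns_isAcyclic (n s : ℕ) : (Tns n s).IsAcyclic := by
  refine isAcyclic_of_rank (Sum.elim (fun i => (i : ℕ)) fun _ => n) ?_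
  rintro (v | v | v) (a | a | a) (b | b | b) <;>
    simp only [Tns, SimpleGraph.fromRel_adj, Sum.elim_inl, Sum.elim_inr, Sum.inl.injEq,
      Sum.inr.injEq, Fin.ext_iff] <;> grind

/-- The distance of a vertex of `T_{n,s}` from the left end. -/
def pos (n s : ℕ) : Fin (n - 2 * s) ⊕ Fin s ⊕ Fin s → ℕ
  | Sum.inl i => i + 1
  | Sum.inr (Sum.inl _) => 0
  | Sum.inr (Sum.inr _) => n - 2 * s + 1

theorem pos_eq_or_of_adj {n s : ℕ} (hn : 2 * s + 3 ≤ n) {a b : Fin (n - 2 * s) ⊕ Fin s ⊕ Fin s}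
    (h : (Tns n s).Adj a b) : pos n s a = pos n s b + 1 ∨ pos n s b = pos n s a + 1 := by
  revert h
  rcases a with a | a | a <;> rcases b with b | b | b <;>
    simp only [Tns, SimpleGraph.fromRel_adj, pos] <;> grind

/-- A subtree with vertices on both sides of a path vertex contains that vertex. -/
theorem mem_of_pos_lt_of_lt_pos {n s : ℕ} (hn : 2 * s + 3 ≤ n) {H : (Tns n s).Subgraph}
    (hH : H ∈ subtrees (Tns n s)) {a b : Fin (n - 2 * s) ⊕ Fin s ⊕ Fin s}
    (ha : a ∈ H.verts) (hb : b ∈ H.verts) (m : Fin (n - 2 * s))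
    (ham : pos n s a < m + 1) (hmb : (m : ℕ) + 1 < pos n s b) : Sum.inl m ∈ H.verts := by
  by_contra hm
  have hne : ∀ x ∈ H.verts, pos n s x ≠ m + 1 := by
    rintro (x | x | x) hx hxm
    · have : x = m := Fin.ext (by simpa [pos] using hxm)
      exact hm (this ▸ hx)
    · simp [pos] at hxm
    · simp only [pos] at hxm
      omega
  have := subtree_constant hH (fun x => pos n s x < m + 1) (fun x _ y hy hxy hlt => by
    have h1 := pos_eq_or_of_adj hn hxy
    have h2 := hne y hy
    omega) ha hb ham
  omega

/-- The subtrees of `T_{n,s}` that contain its whole path. -/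
def spanningSubtrees (n s : ℕ) : Set (Tns n s).Subgraph :=
  {H ∈ subtrees (Tns n s) | ∀ m, Sum.inl m ∈ H.verts}

theorem induce_mem_subtrees {n s : ℕ} (hn : 2 * s + 3 ≤ n)
    {S : Set (Fin (n - 2 * s) ⊕ Fin s ⊕ Fin s)} (hS : ∀ m, Sum.inl m ∈ S) :
    (⊤ : (Tns n s).Subgraph).induce S ∈ subtrees (Tns n s) := by
  set H := (⊤ : (Tns n s).Subgraph).induce S
  have hadj : ∀ (x y : H.verts), (Tns n s).Adj x y → H.coe.Adj x y := fun x y h =>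
    ⟨x.2, y.2, h⟩
  have hpath : ∀ i (hi : i < n - 2 * s), H.coe.Reachable ⟨Sum.inl ⟨0, by omega⟩, hS _⟩
      ⟨Sum.inl ⟨i, hi⟩, hS _⟩ := by
    intro i
    induction i with
    | zero => exact fun _ => SimpleGraph.Reachable.refl _
    | succ i ih =>
      intro hi
      refine (ih (by omega)).trans (SimpleGraph.Adj.reachable (hadj _ _ ?_))
      simp [Tns]
  have hroot : ∀ x : H.verts, H.coe.Reachable ⟨Sum.inl ⟨0, by omega⟩, hS _⟩ x := by
    rintro ⟨x | x | x, hx⟩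
    · exact hpath x x.2
    · refine SimpleGraph.Adj.reachable (hadj _ _ ?_)
      simp [Tns]
    · refine (hpath (n - 2 * s - 1) (by omega)).trans (SimpleGraph.Adj.reachable (hadj _ _ ?_))
      simp [Tns]
  have hconn : H.coe.Connected :=
    { preconnected := fun x y => (hroot x).symm.trans (hroot y)
      nonempty := ⟨⟨Sum.inl ⟨0, by omega⟩, hS _⟩⟩ }
  exact ⟨hconn, (Tns_isAcyclic n s).subgraph H⟩

theorem four_pow_le_ncard_spanningSubtrees {n s : ℕ} (hn : 2 * s + 3 ≤ n) :
    4 ^ s ≤ (spanningSubtrees n s).ncard := by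
  let f : Set (Fin s ⊕ Fin s) → (Tns n s).Subgraph := fun A =>
    (⊤ : (Tns n s).Subgraph).induce (Set.range Sum.inl ∪ Sum.inr '' A)
  have hf : Function.Injective f := by
    intro A B h
    have hv : (f A).verts = (f B).verts := by rw [h]
    ext x
    have := Set.ext_iff.1 hv (Sum.inr x)
    simpa [f] using this
  have hsub : Set.range f ⊆ spanningSubtrees n s := by
    rintro _ ⟨A, rfl⟩
    have hS : ∀ m, Sum.inl m ∈ (Set.range Sum.inl ∪ Sum.inr '' A :
      Set (Fin (n - 2 * s) ⊕ Fin s ⊕ Fin s)) := by simp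
    exact ⟨induce_mem_subtrees hn hS, hS⟩
  calc 4 ^ s = (Set.range f).ncard := by
        rw [← Nat.card_coe_set_eq, Nat.card_range_of_injective hf]
        simp [Nat.card_eq_fintype_card, ← two_mul, pow_mul]
    _ ≤ _ := Set.ncard_le_ncard hsub (Set.toFinite _)

/-- Vertex sets `A ∪ {i < m}`, `A ∪ {i > m}` (with `A` a set of leaves on the left, respectively
on the right), and intervals of the path. -/
def partialSet (n s : ℕ) : (Bool × Set (Fin s) × Fin n) ⊕ (Fin n × Fin n) →
    Set (Fin (n - 2 * s) ⊕ Fin s ⊕ Fin s)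
  | Sum.inl (true, A, m) =>
    {x | Sum.elim (fun i : Fin (n - 2 * s) => (i : ℕ) < m) (Sum.elim (· ∈ A) fun _ => False) x}
  | Sum.inl (false, A, m) =>
    {x | Sum.elim (fun i : Fin (n - 2 * s) => (m : ℕ) < i) (Sum.elim (fun _ => False) (· ∈ A)) x}
  | Sum.inr (a, b) =>
    {x | Sum.elim (fun i : Fin (n - 2 * s) => (a : ℕ) ≤ i ∧ (i : ℕ) ≤ b) (fun _ => False) x}

theorem verts_mem_range_partialSet {n s : ℕ} (hn : 2 * s + 3 ≤ n) {H : (Tns n s).Subgraph}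
    (hH : H ∈ subtrees (Tns n s)) {m : Fin (n - 2 * s)} (hm : Sum.inl m ∉ H.verts) :
    H.verts ∈ Set.range (partialSet n s) := by
  classical
  have hne : (Finset.filter (fun i : Fin (n - 2 * s) => Sum.inl i ∉ H.verts) Finset.univ).Nonempty :=
    ⟨m, by simpa using hm⟩
  by_cases hl : ∃ l, Sum.inr (Sum.inl l) ∈ H.verts
  · obtain ⟨l, hl⟩ := hl
    obtain ⟨k, hk, hkmin⟩ := Finset.exists_min_image _ (fun i : Fin (n - 2 * s) => (i : ℕ)) hne
    simp only [Finset.mem_filter, Finset.mem_univ, true_and] at hk hkmin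
    have hout : ∀ x ∈ H.verts, pos n s x ≤ k + 1 := fun x hx => by
      by_contra! h
      exact hk (mem_of_pos_lt_of_lt_pos hn hH hl hx k (by simp [pos]) h)
    refine ⟨Sum.inl (true, {l | Sum.inr (Sum.inl l) ∈ H.verts}, ⟨k, by omega⟩), ?_⟩
    ext (x | x | x)
    · simp only [partialSet, Set.mem_ofPred_eq, Sum.elim_inl]
      refine ⟨fun h => ?_, fun h => ?_⟩
      · by_contra hx
        have := hkmin x hx
        omega
      · have h1 := hout _ h
        have h2 : (x : ℕ) ≠ k := fun h2 => hk (Fin.ext h2 ▸ h)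
        simp only [pos] at h1
        omega
    · simp [partialSet]
    · simp only [partialSet, Set.mem_ofPred_eq, Sum.elim_inr, false_iff]
      intro hx
      have := hout _ hx
      simp only [pos] at this
      omega
  by_cases hr : ∃ l, Sum.inr (Sum.inr l) ∈ H.verts
  · obtain ⟨l, hr⟩ := hr
    obtain ⟨k, hk, hkmax⟩ := Finset.exists_max_image _ (fun i : Fin (n - 2 * s) => (i : ℕ)) hne
    simp only [Finset.mem_filter, Finset.mem_univ, true_and] at hk hkmax
    have hout : ∀ x ∈ H.verts, k + 1 ≤ pos n s x := fun x hx => by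
      by_contra! h
      exact hk (mem_of_pos_lt_of_lt_pos hn hH hx hr k h (by simp [pos]))
    refine ⟨Sum.inl (false, {l | Sum.inr (Sum.inr l) ∈ H.verts}, ⟨k, by omega⟩), ?_⟩
    ext (x | x | x)
    · simp only [partialSet, Set.mem_ofPred_eq, Sum.elim_inl]
      refine ⟨fun h => ?_, fun h => ?_⟩
      · by_contra hx
        have := hkmax x hx
        omega
      · have h1 := hout _ h
        have h2 : (x : ℕ) ≠ k := fun h2 => hk (Fin.ext h2 ▸ h)
        simp only [pos] at h1
        omega
    · simpa [partialSet] using fun hx => hl ⟨x, hx⟩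
    · simp [partialSet]
  have hH' : H.coe.IsTree := hH
  have hne' : (Finset.filter (fun i : Fin (n - 2 * s) => Sum.inl i ∈ H.verts) Finset.univ).Nonempty := by
    obtain ⟨⟨x | x | x, hx⟩⟩ := hH'.connected.nonempty
    · exact ⟨x, by simpa using hx⟩
    · exact (hl ⟨x, hx⟩).elim
    · exact (hr ⟨x, hx⟩).elim
  obtain ⟨a, ha, hamin⟩ := Finset.exists_min_image _ (fun i : Fin (n - 2 * s) => (i : ℕ)) hne'
  obtain ⟨b, hb, hbmax⟩ := Finset.exists_max_image _ (fun i : Fin (n - 2 * s) => (i : ℕ)) hne'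
  simp only [Finset.mem_filter, Finset.mem_univ, true_and] at ha hamin hb hbmax
  refine ⟨Sum.inr (⟨a, by omega⟩, ⟨b, by omega⟩), ?_⟩
  ext (x | x | x)
  · simp only [partialSet, Set.mem_ofPred_eq, Sum.elim_inl]
    refine ⟨fun ⟨h1, h2⟩ => ?_, fun h => ⟨hamin x h, hbmax x h⟩⟩
    rcases h1.eq_or_lt with h1 | h1
    · exact Fin.ext h1 ▸ ha
    rcases h2.eq_or_lt with h2 | h2
    · exact (Fin.ext h2 : x = b) ▸ hb
    exact mem_of_pos_lt_of_lt_pos hn hH ha hb x (by simpa [pos] using h1) (by simpa [pos] using h2)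
  · simpa [partialSet] using fun hx => hl ⟨x, hx⟩
  · simpa [partialSet] using fun hx => hr ⟨x, hx⟩

theorem ncard_diff_spanningSubtrees_le {n s : ℕ} (hn : 2 * s + 3 ≤ n) :
    (subtrees (Tns n s) \ spanningSubtrees n s).ncard ≤ 2 * (2 ^ s * n) + n * n := by
  calc _ ≤ (Set.range (partialSet n s)).ncard := by
        refine Set.ncard_le_ncard_of_injOn (fun H => H.verts) ?_
          ((verts_injOn_subtrees (Tns_isAcyclic n s)).mono Set.sdiff_subset) (Set.toFinite _)
        rintro H ⟨hH, hH'⟩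
        obtain ⟨m, hm⟩ : ∃ m, Sum.inl m ∉ H.verts := by
          by_contra! h
          exact hH' ⟨hH, h⟩
        exact verts_mem_range_partialSet hn hH hm
    _ ≤ Nat.card ((Bool × Set (Fin s) × Fin n) ⊕ (Fin n × Fin n)) := by
        rw [← Nat.card_coe_set_eq]
        exact Finite.card_range_le _
    _ = _ := by simp [Nat.card_eq_fintype_card]

theorem mu_Tns_eq (n s : ℕ) : mu (Tns n s) =
    (∑ H ∈ (subtrees (Tns n s)).toFinite.toFinset, (H.verts.ncard : ℝ)) /
      (subtrees (Tns n s)).ncard := by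
  rw [mu, numSubtrees, finsum_mem_eq_finite_toFinset_sum]

theorem den_Tns_le_one (n s : ℕ) : den (Tns n s) ≤ 1 := by
  rw [den, mu_Tns_eq]
  have hcard : ∀ H : (Tns n s).Subgraph, (H.verts.ncard : ℝ) ≤
      Fintype.card (Fin (n - 2 * s) ⊕ Fin s ⊕ Fin s) := fun H => by
    rw [← Nat.card_eq_fintype_card]
    exact_mod_cast Set.ncard_le_card _
  refine div_le_one_of_le₀ (div_le_of_le_mul₀ (by positivity) (by positivity) ?_) (by positivity)
  refine (Finset.sum_le_sum fun H _ => hcard H).trans ?_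
  rw [Finset.sum_const, nsmul_eq_mul, Set.ncard_eq_toFinset_card _ (Set.toFinite _), mul_comm]

theorem le_den_Tns {n s : ℕ} (hn : 2 * s + 3 ≤ n) (hs : n ^ 2 ≤ 2 ^ s) :
    (1 - 2 * ((s : ℝ) / n)) / (1 + 3 / n) ≤ den (Tns n s) := by
  have hn0 : (0 : ℝ) < n := by exact_mod_cast (by omega : 0 < n)
  have hsub : spanningSubtrees n s ⊆ subtrees (Tns n s) := Set.sep_subset _ _
  set g := (spanningSubtrees n s).ncard with hg
  set B := (subtrees (Tns n s) \ spanningSubtrees n s).ncard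
  have htotal : (subtrees (Tns n s)).ncard = B + g :=
    (Set.ncard_sdiff_add_ncard_of_subset hsub (Set.toFinite _)).symm
  have hg4 : 4 ^ s ≤ g := four_pow_le_ncard_spanningSubtrees hn
  have hB : B ≤ 2 * (2 ^ s * n) + n * n := ncard_diff_spanningSubtrees_le hn
  have hnB : n * B ≤ 3 * g := by
    have h4 : (4 : ℕ) ^ s = 2 ^ s * 2 ^ s := by
      rw [← mul_pow]
      norm_num
    calc n * B ≤ n * (3 * (2 ^ s * n)) := Nat.mul_le_mul_left _ (by nlinarith)
      _ = 3 * (2 ^ s * n ^ 2) := by ring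
      _ ≤ 3 * (2 ^ s * 2 ^ s) := by gcongr
      _ ≤ 3 * g := by omega
  have hgpos : 0 < g := lt_of_lt_of_le (by positivity) hg4
  have hg0 : (0 : ℝ) < g := by
    exact_mod_cast hgpos
  have hsum : (g : ℝ) * (n - 2 * s) ≤
      ∑ H ∈ (subtrees (Tns n s)).toFinite.toFinset, (H.verts.ncard : ℝ) := by
    have horder : ∀ H ∈ (spanningSubtrees n s).toFinite.toFinset,
        ((n : ℝ) - 2 * s) ≤ H.verts.ncard := by
      intro H hH
      have hH' : H ∈ spanningSubtrees n s := by simpa using hH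
      have h1 : (Set.range (Sum.inl : Fin (n - 2 * s) → _ ⊕ Fin s ⊕ Fin s)).ncard ≤
          H.verts.ncard :=
        Set.ncard_le_ncard (by rintro _ ⟨m, rfl⟩; exact hH'.2 m) (Set.toFinite _)
      rw [← Nat.card_coe_set_eq, Nat.card_range_of_injective Sum.inl_injective,
        Nat.card_eq_fintype_card, Fintype.card_fin] at h1
      have h2 : n ≤ H.verts.ncard + 2 * s := by omega
      have h3 : (n : ℝ) ≤ H.verts.ncard + 2 * s := by exact_mod_cast h2
      linarith
    calc (g : ℝ) * (n - 2 * s)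
        = ∑ H ∈ (spanningSubtrees n s).toFinite.toFinset, ((n : ℝ) - 2 * s) := by
          rw [Finset.sum_const, nsmul_eq_mul, hg, Set.ncard_eq_toFinset_card _ (Set.toFinite _)]
      _ ≤ ∑ H ∈ (spanningSubtrees n s).toFinite.toFinset, (H.verts.ncard : ℝ) :=
          Finset.sum_le_sum horder
      _ ≤ _ := Finset.sum_le_sum_of_subset_of_nonneg (by simpa using hsub)
          fun _ _ _ => by positivity
  have hcard : Fintype.card (Fin (n - 2 * s) ⊕ Fin s ⊕ Fin s) = n := by
    simp only [Fintype.card_sum, Fintype.card_fin]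
    omega
  have hnB' : (n : ℝ) * B ≤ 3 * g := by exact_mod_cast hnB
  have hns : (0 : ℝ) ≤ n - 2 * s := by
    have : ((2 * s + 3 : ℕ) : ℝ) ≤ n := by exact_mod_cast hn
    push_cast at this
    linarith
  rw [den, mu_Tns_eq, hcard, htotal, div_div]
  calc (1 - 2 * ((s : ℝ) / n)) / (1 + 3 / n)
      = g * (n - 2 * s) / (g * (n + 3)) := by
        field_simp
    _ ≤ g * (n - 2 * s) / (((B + g : ℕ) : ℝ) * n) := by
        refine div_le_div_of_nonneg_left (by positivity) (mul_pos ?_ hn0) ?_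
        · exact_mod_cast (by omega : 0 < B + g)
        push_cast
        linarith
    _ ≤ _ := by gcongr

/-- If `2·s_n ≤ n - 3` for all `n ≥ k`, `s_n/n → 0`, and `2^{s_n} ≥ n²` for all
`n ≥ k`, then `Den(T_n) → 1` where `T_n = T_{n,s_n}`. -/
theorem den_Tns_tendsto_one (k : ℕ) (sq : ℕ → ℕ)
    (ha : ∀ n, k ≤ n → 2 * sq n + 3 ≤ n)
    (hb : Tendsto (fun n : ℕ => (sq n : ℝ) / n) atTop (𝓝 0))
    (hc : ∀ n, k ≤ n → n ^ 2 ≤ 2 ^ sq n) :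
    Tendsto (fun n : ℕ => den (Tns n (sq n))) atTop (𝓝 1) := by
  have hlow : Tendsto (fun n : ℕ => (1 - 2 * ((sq n : ℝ) / n)) / (1 + 3 / (n : ℝ))) atTop (𝓝 1) := by
    have h := (tendsto_const_nhds (x := (1 : ℝ))).sub (hb.const_mul 2)
    have h' := (tendsto_const_nhds (x := (1 : ℝ))).add (tendsto_const_div_atTop_nhds_zero_nat 3)
    have h'' := h.div h' (by norm_num)
    rw [mul_zero, sub_zero, add_zero, div_one] at h''
    exact h''
  refine tendsto_of_tendsto_of_tendsto_of_le_of_le' hlow tendsto_const_nhds ?_ ?_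
  · filter_upwards [eventually_ge_atTop k] with n hn using le_den_Tns (ha n hn) (hc n hn)
  · exact Eventually.of_forall fun n => den_Tns_le_one n (sq n)

end SubtreePaper
end
end

section
/- Let {s_n}_{n ≥ k} be a sequence of nonnegative integers such that (a) 2·s_n ≤ n − 3 for all n ≥ k, (b) s_n/n → 0 as n → ∞, and (c) 2^{s_n} ≥ n² for all n ≥ k. Let T_n = T_{n,s_n} and let G_n be obtained from T_n by adding the edge uv. Then the ratio (number of subtrees of T_n)/(number of subtrees of G_n) tends to 0 as n → ∞. -/
open Filter Topology

noncomputable section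

namespace SubtreePaper

theorem isTree_of_parent {V : Type*} [Finite V] (G : SimpleGraph V) (r : V) (f : V → V)
    (h : V → ℕ) (hlt : ∀ x, x ≠ r → h (f x) < h x)
    (hadj : ∀ x y, G.Adj x y ↔ (x ≠ r ∧ y = f x) ∨ (y ≠ r ∧ x = f y)) : G.IsTree := by
  rw [SimpleGraph.isTree_iff_connected_and_card]
  have hreach : ∀ m x, h x ≤ m → G.Reachable x r := by
    intro m
    induction m with
    | zero =>
      intro x hx
      by_cases hxr : x = r
      · rw [hxr]
      · have := hlt x hxr
        omega
    | succ m ih =>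
      intro x hx
      by_cases hxr : x = r
      · rw [hxr]
      · have := hlt x hxr
        exact ((hadj x (f x)).2 (Or.inl ⟨hxr, rfl⟩)).reachable.trans (ih _ (by omega))
  refine ⟨(SimpleGraph.connected_iff _).2
    ⟨fun x y => (hreach _ x le_rfl).trans (hreach _ y le_rfl).symm, ⟨r⟩⟩, ?_⟩
  have himage : G.edgeSet = (fun x => s(x, f x)) '' {r}ᶜ := by
    ext e
    induction e with
    | _ x y =>
      simp only [SimpleGraph.mem_edgeSet, hadj, Set.mem_image, Set.mem_compl_iff,
        Set.mem_singleton_iff, Sym2.eq_iff]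
      constructor
      · rintro (⟨h1, h2⟩ | ⟨h1, h2⟩)
        · exact ⟨x, h1, Or.inl ⟨rfl, h2.symm⟩⟩
        · exact ⟨y, h1, Or.inr ⟨rfl, h2.symm⟩⟩
      · rintro ⟨z, hz, (⟨rfl, rfl⟩ | ⟨rfl, rfl⟩)⟩
        · exact Or.inl ⟨hz, rfl⟩
        · exact Or.inr ⟨hz, rfl⟩
  have hinj : Set.InjOn (fun x => s(x, f x)) ({r}ᶜ : Set V) := by
    intro x hx y hy hxy
    rcases Sym2.eq_iff.1 hxy with ⟨h1, -⟩ | ⟨h1, h2⟩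
    · exact h1
    · have hx' := hlt x hx
      have hy' := hlt y hy
      rw [h2] at hx'
      rw [← h1] at hy'
      omega
  rw [Nat.card_coe_set_eq, himage, hinj.ncard_image]
  have := Set.ncard_add_ncard_compl ({r} : Set V)
  rw [Set.ncard_singleton] at this
  omega

theorem exists_adj_of_mem_subtrees {V : Type*} {G : SimpleGraph V} {H : G.Subgraph}
    (hH : H ∈ subtrees G) (S : Set V) {x y : V} (hx : x ∈ H.verts) (hy : y ∈ H.verts)
    (hxS : x ∈ S) (hyS : y ∉ S) : ∃ a b, H.Adj a b ∧ a ∈ S ∧ b ∉ S := by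
  have hconn : H.coe.Connected := hH.connected
  obtain ⟨w⟩ := hconn.preconnected ⟨x, hx⟩ ⟨y, hy⟩
  obtain ⟨d, -, h1, h2⟩ := w.exists_boundary_dart (Subtype.val ⁻¹' S) hxS hyS
  exact ⟨d.fst, d.snd, d.adj, h1, h2⟩

/-- The path vertices up to position `i`, together with the leaves at `u`. -/
def initialPart (n s i : ℕ) : Set (Fin (n - 2 * s) ⊕ Fin s ⊕ Fin s) :=
  {x | match x with
    | Sum.inl k => (k : ℕ) ≤ i
    | Sum.inr (Sum.inl _) => True
    | Sum.inr (Sum.inr _) => False}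

theorem Tns_adj_initialPart {n s i : ℕ} (hi : i + 1 < n - 2 * s)
    {a b : Fin (n - 2 * s) ⊕ Fin s ⊕ Fin s} (hab : (Tns n s).Adj a b)
    (ha : a ∈ initialPart n s i) (hb : b ∉ initialPart n s i) :
    a = Sum.inl ⟨i, by omega⟩ ∧ b = Sum.inl ⟨i + 1, hi⟩ := by
  rcases a with a | a | a <;> rcases b with b | b | b <;>
    simp [Tns, initialPart, Fin.ext_iff] at hab ha hb ⊢ <;> omega

theorem adj_of_mem_initialPart {n s i : ℕ} (hi : i + 1 < n - 2 * s)
    {H : (Tns n s).Subgraph} (hH : H ∈ subtrees (Tns n s))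
    {x y : Fin (n - 2 * s) ⊕ Fin s ⊕ Fin s} (hx : x ∈ H.verts) (hy : y ∈ H.verts)
    (hxi : x ∈ initialPart n s i) (hyi : y ∉ initialPart n s i) :
    H.Adj (Sum.inl ⟨i, by omega⟩) (Sum.inl ⟨i + 1, hi⟩) := by
  obtain ⟨a, b, hab, ha, hb⟩ := exists_adj_of_mem_subtrees hH _ hx hy hxi hyi
  obtain ⟨rfl, rfl⟩ := Tns_adj_initialPart hi hab.adj_sub ha hb
  exact hab

theorem adj_of_leaf {V : Type*} {G : SimpleGraph V} {H : G.Subgraph}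
    (hH : H ∈ subtrees G) {x y : V} (hx : x ∈ H.verts) (hy : y ∈ H.verts) (hxy : G.Adj x y)
    (hleaf : ∀ z, G.Adj x z → z = y) : H.Adj x y := by
  obtain ⟨a, b, hab, rfl, -⟩ :=
    exists_adj_of_mem_subtrees hH {x} hx hy rfl (fun h => hxy.ne h.symm)
  rwa [← hleaf b hab.adj_sub]

theorem adj_of_mem_subtrees_Tns {n s : ℕ} {H : (Tns n s).Subgraph}
    (hH : H ∈ subtrees (Tns n s)) {x y : Fin (n - 2 * s) ⊕ Fin s ⊕ Fin s}
    (hx : x ∈ H.verts) (hy : y ∈ H.verts) (hxy : (Tns n s).Adj x y) : H.Adj x y := by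
  have hpath : ∀ i j : Fin (n - 2 * s), Sum.inl i ∈ H.verts → Sum.inl j ∈ H.verts →
      (i : ℕ) + 1 = j → H.Adj (Sum.inl i) (Sum.inl j) := by
    rintro ⟨i, hi⟩ ⟨j, hj⟩ hiH hjH hij
    obtain rfl : i + 1 = j := hij
    exact adj_of_mem_initialPart hj hH hiH hjH (by simp [initialPart]) (by simp [initialPart])
  have hleaf : ∀ (c : Fin s ⊕ Fin s) z, (Tns n s).Adj (Sum.inr c) z →
      ∀ w, (Tns n s).Adj (Sum.inr c) w → w = z := by
    intro c z hz w hw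
    rcases c with c | c <;> rcases z with z | z | z <;> rcases w with w | w | w <;>
      simp [Tns, Fin.ext_iff] at hz hw ⊢ <;> omega
  rcases x with x | x
  · rcases y with y | y
    · have hxy' : (x : ℕ) + 1 = y ∨ (y : ℕ) + 1 = x := by
        simp [Tns] at hxy
        exact hxy.2
      rcases hxy' with h | h
      · exact hpath x y hx hy h
      · exact (hpath y x hy hx h).symm
    · exact (adj_of_leaf hH hy hx hxy.symm (hleaf y _ hxy.symm)).symm
  · exact adj_of_leaf hH hx hy hxy (hleaf x _ hxy)

theorem verts_injOn_subtrees_Tns (n s : ℕ) :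
    Set.InjOn SimpleGraph.Subgraph.verts (subtrees (Tns n s)) := by
  intro H hH K hK hHK
  refine SimpleGraph.Subgraph.ext hHK ?_
  ext x y
  constructor
  · intro h
    exact adj_of_mem_subtrees_Tns hK (hHK ▸ h.fst_mem) (hHK ▸ h.snd_mem) h.adj_sub
  · intro h
    exact adj_of_mem_subtrees_Tns hH (hHK.symm ▸ h.fst_mem) (hHK.symm ▸ h.snd_mem) h.adj_sub

/-- The set of vertices made of a set `P` of path vertices, a set `A` of leaves at `u` and a
set `B` of leaves at `v`. -/
def vertexSet {n s : ℕ} (P : Set (Fin (n - 2 * s))) (A B : Set (Fin s)) :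
    Set (Fin (n - 2 * s) ⊕ Fin s ⊕ Fin s) :=
  Sum.elim P (Sum.elim A B)

theorem vertexSet_preimage {n s : ℕ} (S : Set (Fin (n - 2 * s) ⊕ Fin s ⊕ Fin s)) :
    vertexSet (Sum.inl ⁻¹' S) ((fun a => Sum.inr (Sum.inl a)) ⁻¹' S)
      ((fun b => Sum.inr (Sum.inr b)) ⁻¹' S) = S := by
  ext x
  rcases x with x | x | x <;> rfl

theorem exists_Icc_eq {p : ℕ} (hp : 2 ≤ p) (P : Set (Fin p)) (hP : P.OrdConnected) :
    ∃ i j, P = Set.Icc i j := by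
  rcases P.eq_empty_or_nonempty with rfl | hne
  · exact ⟨⟨1, by omega⟩, ⟨0, by omega⟩, (Set.Icc_eq_empty (by simp)).symm⟩
  · obtain ⟨i, hi⟩ := P.toFinite.exists_minimal hne
    obtain ⟨j, hj⟩ := P.toFinite.exists_maximal hne
    refine ⟨i, j, Set.Subset.antisymm (fun x hx => ⟨?_, ?_⟩) (hP.out hi.1 hj.1)⟩
    · exact (le_total i x).elim id (fun h => hi.2 hx h)
    · exact (le_total x j).elim id (fun h => hj.2 hx h)

theorem ordConnected_of_mem_subtrees_Tns {n s : ℕ} {H : (Tns n s).Subgraph}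
    (hH : H ∈ subtrees (Tns n s)) :
    (Sum.inl ⁻¹' H.verts : Set (Fin (n - 2 * s))).OrdConnected := by
  refine ⟨fun i hi k hk j ⟨hij, hjk⟩ => ?_⟩
  rcases hjk.eq_or_lt with rfl | hlt
  · exact hk
  · have hij' : (i : ℕ) ≤ j := hij
    have hlt' : (j : ℕ) < k := hlt
    have hj : (j : ℕ) + 1 < n - 2 * s := by omega
    exact (adj_of_mem_initialPart hj hH hi hk (by simpa [initialPart] using hij')
      (by simpa [initialPart] using hlt')).fst_mem

theorem path_subset_of_mem_subtrees_Tns {n s : ℕ} (h : 2 * s + 3 ≤ n) {H : (Tns n s).Subgraph}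
    (hH : H ∈ subtrees (Tns n s)) {a b : Fin s} (ha : Sum.inr (Sum.inl a) ∈ H.verts)
    (hb : Sum.inr (Sum.inr b) ∈ H.verts) :
    (Sum.inl ⁻¹' H.verts : Set (Fin (n - 2 * s))) = Set.univ := by
  rw [Set.eq_univ_iff_forall]
  rintro ⟨k, hk⟩
  by_cases hk' : k + 1 < n - 2 * s
  · exact (adj_of_mem_initialPart hk' hH ha hb (by simp [initialPart])
      (by simp [initialPart])).fst_mem
  · obtain ⟨k, rfl⟩ : ∃ m, k = m + 1 := ⟨k - 1, by omega⟩
    exact (adj_of_mem_initialPart hk hH ha hb (by simp [initialPart])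
      (by simp [initialPart])).snd_mem

theorem ncard_range_le {α β : Type*} [Finite α] (f : α → β) :
    (Set.range f).ncard ≤ Nat.card α := by
  rw [← Set.image_univ, ← Set.ncard_univ]
  exact Set.ncard_image_le

theorem numSubtrees_Tns_le {n s : ℕ} (h : 2 * s + 3 ≤ n) :
    numSubtrees (Tns n s) ≤ 2 * ((n - 2 * s) ^ 2 * 2 ^ s) + 2 ^ s * 2 ^ s := by
  let F₁ : (Fin (n - 2 * s) × Fin (n - 2 * s)) × Set (Fin s) →
      Set (Fin (n - 2 * s) ⊕ Fin s ⊕ Fin s) :=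
    fun t => vertexSet (Set.Icc t.1.1 t.1.2) t.2 ∅
  let F₂ : (Fin (n - 2 * s) × Fin (n - 2 * s)) × Set (Fin s) →
      Set (Fin (n - 2 * s) ⊕ Fin s ⊕ Fin s) :=
    fun t => vertexSet (Set.Icc t.1.1 t.1.2) ∅ t.2
  let F₃ : Set (Fin s) × Set (Fin s) → Set (Fin (n - 2 * s) ⊕ Fin s ⊕ Fin s) :=
    fun t => vertexSet Set.univ t.1 t.2
  have hsub : SimpleGraph.Subgraph.verts '' subtrees (Tns n s) ⊆
      (Set.range F₁ ∪ Set.range F₂) ∪ Set.range F₃ := by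
    rintro _ ⟨H, hH, rfl⟩
    obtain ⟨i, j, hij⟩ := exists_Icc_eq (by omega) _ (ordConnected_of_mem_subtrees_Tns hH)
    have hS := vertexSet_preimage H.verts
    rcases ((fun a => Sum.inr (Sum.inl a)) ⁻¹' H.verts).eq_empty_or_nonempty with hA | ⟨a, ha⟩
    · refine Or.inl (Or.inr ⟨((i, j), (fun b => Sum.inr (Sum.inr b)) ⁻¹' H.verts), ?_⟩)
      rw [hA, hij] at hS
      exact hS
    rcases ((fun b => Sum.inr (Sum.inr b)) ⁻¹' H.verts).eq_empty_or_nonempty with hB | ⟨b, hb⟩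
    · refine Or.inl (Or.inl ⟨((i, j), (fun a => Sum.inr (Sum.inl a)) ⁻¹' H.verts), ?_⟩)
      rw [hB, hij] at hS
      exact hS
    · refine Or.inr ⟨((fun a => Sum.inr (Sum.inl a)) ⁻¹' H.verts,
        (fun b => Sum.inr (Sum.inr b)) ⁻¹' H.verts), ?_⟩
      rw [path_subset_of_mem_subtrees_Tns h hH ha hb] at hS
      exact hS
  have h₁ := ncard_range_le F₁
  have h₂ := ncard_range_le F₂
  have h₃ := ncard_range_le F₃
  simp only [Nat.card_eq_fintype_card, Fintype.card_prod, Fintype.card_fin, Fintype.card_set]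
    at h₁ h₂ h₃
  rw [numSubtrees, ← (verts_injOn_subtrees_Tns n s).ncard_image]
  calc _ ≤ _ := Set.ncard_le_ncard hsub (Set.toFinite _)
    _ ≤ _ := Set.ncard_union_le _ _
    _ ≤ _ := Nat.add_le_add_right (Set.ncard_union_le _ _) _
    _ ≤ _ := by
      rw [pow_two]
      omega

/-- The parent of a vertex in the spanning tree of `G_{n,s}` rooted at `u` that omits the path
edge between positions `i` and `i + 1`. -/
def parent (n s : ℕ) (h : 2 * s + 3 ≤ n) (i : ℕ) :
    Fin (n - 2 * s) ⊕ Fin s ⊕ Fin s → Fin (n - 2 * s) ⊕ Fin s ⊕ Fin s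
  | Sum.inl k =>
    if (k : ℕ) ≤ i then Sum.inl ⟨k - 1, by omega⟩
    else if hk : (k : ℕ) + 1 < n - 2 * s then Sum.inl ⟨k + 1, hk⟩
    else pu n s h
  | Sum.inr (Sum.inl _) => pu n s h
  | Sum.inr (Sum.inr _) => pv n s h

/-- The depth of a vertex in the spanning tree described by `parent`. -/
def depth (n s i : ℕ) : Fin (n - 2 * s) ⊕ Fin s ⊕ Fin s → ℕ
  | Sum.inl k => if (k : ℕ) ≤ i then k else n - 2 * s - k
  | Sum.inr (Sum.inl _) => 1
  | Sum.inr (Sum.inr _) => 2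

theorem depth_parent_lt {n s : ℕ} (h : 2 * s + 3 ≤ n) {i : ℕ} (hi : i + 1 < n - 2 * s)
    (x : Fin (n - 2 * s) ⊕ Fin s ⊕ Fin s) (hx : x ≠ pu n s h) :
    depth n s i (parent n s h i x) < depth n s i x := by
  rcases x with ⟨k, hk⟩ | x | x
  · simp only [pu, ne_eq, Sum.inl.injEq, Fin.mk.injEq] at hx
    simp only [parent, pu]
    split_ifs <;> simp only [depth] <;> split_ifs <;> omega
  · simp [parent, depth, pu]
  · simp only [parent, depth, pv]
    split_ifs <;> omega

theorem Gns_adj_parent {n s : ℕ} (h : 2 * s + 3 ≤ n) (i : ℕ)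
    (x : Fin (n - 2 * s) ⊕ Fin s ⊕ Fin s) (hx : x ≠ pu n s h) :
    (Gns n s h).Adj x (parent n s h i x) := by
  rcases x with ⟨k, hk⟩ | x | x
  · simp only [pu, ne_eq, Sum.inl.injEq, Fin.mk.injEq] at hx
    simp only [parent, pu]
    split_ifs <;> simp [Gns, addEdge, Tns, pu, pv] <;> omega
  · simp [Gns, addEdge, Tns, parent, pu]
  · simp [Gns, addEdge, Tns, parent, pv]

theorem parent_mem_vertexSet {n s : ℕ} (h : 2 * s + 3 ≤ n) (i : ℕ) (A B : Set (Fin s))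
    (x : Fin (n - 2 * s) ⊕ Fin s ⊕ Fin s) : parent n s h i x ∈ vertexSet Set.univ A B := by
  have hinl : ∀ k, Sum.inl k ∈ vertexSet (Set.univ : Set (Fin (n - 2 * s))) A B :=
    fun _ => trivial
  rcases x with x | x | x
  · simp only [parent]
    split_ifs <;> exact hinl _
  · exact hinl _
  · exact hinl _

/-- The subtree of `G_{n,s}` containing the edge `uv`, all path vertices and the sets `A`, `B`
of leaves, that omits the path edge between positions `i` and `i + 1`. -/
def cutTree (n s : ℕ) (h : 2 * s + 3 ≤ n) (i : ℕ) (A B : Set (Fin s)) :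
    (Gns n s h).Subgraph where
  verts := vertexSet Set.univ A B
  Adj x y := x ∈ vertexSet Set.univ A B ∧ y ∈ vertexSet Set.univ A B ∧
    ((x ≠ pu n s h ∧ y = parent n s h i x) ∨ (y ≠ pu n s h ∧ x = parent n s h i y))
  adj_sub := by
    rintro x y ⟨-, -, ⟨hx, rfl⟩ | ⟨hy, rfl⟩⟩
    · exact Gns_adj_parent h i x hx
    · exact (Gns_adj_parent h i y hy).symm
  edge_vert := fun hxy => hxy.1
  symm := ⟨fun _ _ ⟨hx, hy, hxy⟩ => ⟨hy, hx, hxy.symm⟩⟩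

theorem cutTree_mem_subtrees {n s : ℕ} (h : 2 * s + 3 ≤ n) {i : ℕ} (hi : i + 1 < n - 2 * s)
    (A B : Set (Fin s)) : cutTree n s h i A B ∈ subtrees (Gns n s h) := by
  refine isTree_of_parent _ ⟨pu n s h, trivial⟩
    (fun x => ⟨parent n s h i x, parent_mem_vertexSet h i A B x⟩) (fun x => depth n s i x) ?_ ?_
  · rintro ⟨x, hx⟩ hne
    exact depth_parent_lt h hi x (fun hx' => hne (Subtype.ext hx'))
  · rintro ⟨x, hx⟩ ⟨y, hy⟩
    simp only [SimpleGraph.Subgraph.coe_adj, ne_eq, Subtype.ext_iff]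
    exact ⟨fun hxy => hxy.2.2, fun hxy => ⟨hx, hy, hxy⟩⟩

theorem cutTree_adj_iff {n s : ℕ} (h : 2 * s + 3 ≤ n) (i : ℕ) (A B : Set (Fin s))
    {j : ℕ} (hj : j + 1 < n - 2 * s) :
    (cutTree n s h i A B).Adj (Sum.inl ⟨j, by omega⟩) (Sum.inl ⟨j + 1, hj⟩) ↔ j ≠ i := by
  have hinl : ∀ k, Sum.inl k ∈ vertexSet (Set.univ : Set (Fin (n - 2 * s))) A B :=
    fun _ => trivial
  simp only [cutTree, hinl, true_and, parent, pu, ne_eq, Sum.inl.injEq, Fin.mk.injEq]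
  split_ifs <;> simp <;> omega

theorem le_numSubtrees_Gns {n s : ℕ} (h : 2 * s + 3 ≤ n) :
    (n - 2 * s - 1) * (2 ^ s * 2 ^ s) ≤ numSubtrees (Gns n s h) := by
  let F : Fin (n - 2 * s - 1) × Set (Fin s) × Set (Fin s) → (Gns n s h).Subgraph :=
    fun t => cutTree n s h t.1 t.2.1 t.2.2
  have hF : Function.Injective F := by
    rintro ⟨i, A, B⟩ ⟨i', A', B'⟩ hEq
    have hverts : vertexSet (n := n) Set.univ A B = vertexSet Set.univ A' B' :=
      congrArg SimpleGraph.Subgraph.verts hEq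
    have hA : A = A' := congrArg (fun S => (fun a => Sum.inr (Sum.inl a)) ⁻¹' S) hverts
    have hB : B = B' := congrArg (fun S => (fun b => Sum.inr (Sum.inr b)) ⁻¹' S) hverts
    have hi : (i : ℕ) + 1 < n - 2 * s := by omega
    have h₁ := cutTree_adj_iff h i A B hi
    have h₂ := cutTree_adj_iff h i' A' B' hi
    have hEq' : cutTree n s h i A B = cutTree n s h i' A' B' := hEq
    rw [hEq', h₂] at h₁
    have hii : i = i' := Fin.ext (by simpa using h₁)
    rw [hA, hB, hii]
  have hcard : (Set.range F).ncard = (n - 2 * s - 1) * (2 ^ s * 2 ^ s) := by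
    rw [← Set.image_univ, Set.ncard_image_of_injective _ hF, Set.ncard_univ]
    simp only [Nat.card_eq_fintype_card, Fintype.card_prod, Fintype.card_fin, Fintype.card_set]
  rw [← hcard, numSubtrees]
  refine Set.ncard_le_ncard ?_ (Set.toFinite _)
  rintro _ ⟨⟨i, A, B⟩, rfl⟩
  exact cutTree_mem_subtrees h (by omega) A B

theorem ratio_le {n s : ℕ} (h : 2 * s + 3 ≤ n) (hn : n ^ 2 ≤ 2 ^ s) (h8 : 8 * s ≤ n) :
    (numSubtrees (Tns n s) : ℝ) / GnsNum n s ≤ 9 / n := by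
  have hT : numSubtrees (Tns n s) ≤ 3 * (2 ^ s * 2 ^ s) := by
    refine (numSubtrees_Tns_le h).trans ?_
    have : (n - 2 * s) ^ 2 * 2 ^ s ≤ 2 ^ s * 2 ^ s :=
      Nat.mul_le_mul_right _ ((Nat.pow_le_pow_left (Nat.sub_le _ _) 2).trans hn)
    omega
  have hG := le_numSubtrees_Gns h
  rw [GnsNum, dif_pos h]
  have hlin : n ≤ 3 * (n - 2 * s - 1) := by omega
  have hpos : 0 < n - 2 * s - 1 := by omega
  have hGpos : 0 < numSubtrees (Gns n s h) := lt_of_lt_of_le (by positivity) hG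
  rw [div_le_div_iff₀ (by exact_mod_cast hGpos) (by exact_mod_cast (by omega : 0 < n))]
  have hmain : numSubtrees (Tns n s) * n ≤ 9 * numSubtrees (Gns n s h) := by
    calc _ ≤ 3 * (2 ^ s * 2 ^ s) * (3 * (n - 2 * s - 1)) := Nat.mul_le_mul hT hlin
      _ = 9 * ((n - 2 * s - 1) * (2 ^ s * 2 ^ s)) := by ring
      _ ≤ _ := Nat.mul_le_mul_left _ hG
  exact_mod_cast hmain

/-- If `2·s_n ≤ n - 3` for all `n ≥ k`, `s_n/n → 0`, and `2^{s_n} ≥ n²` for all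
`n ≥ k`, then the ratio of the number of subtrees of `T_n = T_{n,s_n}` to the number
of subtrees of `G_n` (which is `T_n` plus the edge `uv`) tends to `0`. -/
theorem ratio_numSubtrees_tendsto_zero (k : ℕ) (sq : ℕ → ℕ)
    (ha : ∀ n, k ≤ n → 2 * sq n + 3 ≤ n)
    (hb : Tendsto (fun n : ℕ => (sq n : ℝ) / n) atTop (𝓝 0))
    (hc : ∀ n, k ≤ n → n ^ 2 ≤ 2 ^ sq n) :
    Tendsto (fun n : ℕ => (numSubtrees (Tns n (sq n)) : ℝ) / (GnsNum n (sq n)))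
      atTop (𝓝 0) := by
  have hlim : Tendsto (fun n : ℕ => (9 : ℝ) / n) atTop (𝓝 0) :=
    tendsto_const_div_atTop_nhds_zero_nat 9
  refine squeeze_zero' (Eventually.of_forall fun n => by positivity) ?_ hlim
  filter_upwards [eventually_ge_atTop k, hb.eventually_lt_const (by norm_num : (0 : ℝ) < 1 / 8)]
    with n hkn hsn
  have h := ha n hkn
  have hn : (0 : ℝ) < n := by exact_mod_cast (by omega : 0 < n)
  rw [div_lt_div_iff₀ hn (by norm_num)] at hsn
  have h8 : (8 : ℝ) * sq n ≤ n := by linarith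
  exact ratio_le h (hc n hkn) (by exact_mod_cast h8)

end SubtreePaper
end
end
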